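/- Assume the generator is human-aligned. Then for every α ∈ (0, 1/2), the number of candidates shared between the portfolio and the human portfolio satisfies |P(α) ∩ P*(α)| > 1 − 2α; in particular, since this cardinality is an integer, |P(α) ∩ P*(α)| ≥ 1. -/

import Mathlib

open Finset

/-- The top-`k` set of a ranking `r` of a finite type `O`: the candidates whose
rank (position under `r`) is among the first `k`. -/
def topk {O : Type*} [Fintype O] [DecidableEq O]
    (r : Fin (Fintype.card O) ≃ O) (k : ℕ) : Finset O :=
  Finset.univ.filter (fun o => ((r.symm o : Fin (Fintype.card O)) : ℕ) < k)

/-- `kstar p r α` is the least `k ≥ 1` such that the probability mass of the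
top-`k` set of the ranking `r` is at least `1 - α`. -/
noncomputable def kstar {O : Type*} [Fintype O] [DecidableEq O]
    (p : O → ℝ) (r : Fin (Fintype.card O) ≃ O) (α : ℝ) : ℕ :=
  sInf {k : ℕ | 1 ≤ k ∧ (1 - α) ≤ ∑ o ∈ topk r k, p o}

section TopK

variable {O : Type*} [Fintype O] [DecidableEq O]

theorem mem_topk {r : Fin (Fintype.card O) ≃ O} {k : ℕ} {o : O} :
    o ∈ topk r k ↔ (r.symm o : ℕ) < k := by
  simp [topk]

theorem topk_card_eq_univ (r : Fin (Fintype.card O) ≃ O) :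
    topk r (Fintype.card O) = Finset.univ := by
  ext o
  simp [mem_topk]

theorem sum_topk (p : O → ℝ) (r : Fin (Fintype.card O) ≃ O) (k : ℕ) :
    ∑ o ∈ topk r k, p o =
      ∑ i ∈ Finset.univ.filter (fun i : Fin (Fintype.card O) => (i : ℕ) < k), p (r i) := by
  refine Finset.sum_equiv r.symm (fun o => ?_) (fun o _ => ?_) <;> simp [mem_topk]

/-- The top-`kstar` set has mass at least `1 - α`. -/
theorem one_sub_le_sum_topk_kstar [Nonempty O] {p : O → ℝ} (hsum : ∑ o, p o = 1)
    (r : Fin (Fintype.card O) ≃ O) {α : ℝ} (hα : 0 ≤ α) :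
    1 - α ≤ ∑ o ∈ topk r (kstar p r α), p o := by
  have hne : {k : ℕ | 1 ≤ k ∧ 1 - α ≤ ∑ o ∈ topk r k, p o}.Nonempty := by
    refine ⟨Fintype.card O, Fintype.card_pos, ?_⟩
    rw [topk_card_eq_univ, hsum]
    linarith
  exact (Nat.sInf_mem hne).2

/-- If `p` is nonincreasing along `h` and the top-`k` sets of `e` and `h` are disjoint, then that
of `h` has at least as much mass. -/
theorem sum_topk_le_sum_topk_of_disjoint {p : O → ℝ} {e h : Fin (Fintype.card O) ≃ O}
    (halign : ∀ i j : Fin (Fintype.card O), i ≤ j → p (h j) ≤ p (h i)) {k : ℕ}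
    (hd : Disjoint (topk e k) (topk h k)) :
    ∑ o ∈ topk e k, p o ≤ ∑ o ∈ topk h k, p o := by
  rw [sum_topk, sum_topk]
  refine Finset.sum_le_sum fun i hi => ?_
  have hik : (i : ℕ) < k := by simpa using hi
  have hnot : e i ∉ topk h k := Finset.disjoint_left.1 hd (mem_topk.2 (by simpa using hik))
  rw [mem_topk, not_lt] at hnot
  simpa using halign i (h.symm (e i)) (Fin.le_def.2 (hik.le.trans hnot))

end TopK

/-- If the generator is human-aligned, then for every α ∈ (0, 1/2),
|P(α) ∩ P*(α)| > 1 - 2α; in particular |P(α) ∩ P*(α)| ≥ 1. -/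
theorem card_inter_gt_one_sub_two_alpha
    (O : Type*) [Fintype O] [DecidableEq O] [Nonempty O]
    (p : O → ℝ) (hp : ∀ o, 0 ≤ p o) (hsum : ∑ o, p o = 1)
    (e h : Fin (Fintype.card O) ≃ O)
    (halign : ∀ i j : Fin (Fintype.card O), i ≤ j → p (h j) ≤ p (h i))
    (α : ℝ) (hα0 : 0 < α) (hα1 : α < 1/2) :
    (1 - 2 * α) < ((topk e (kstar p e α) ∩ topk h (kstar p e α)).card : ℝ) ∧
    1 ≤ (topk e (kstar p e α) ∩ topk h (kstar p e α)).card := by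
  have hcard : 1 ≤ (topk e (kstar p e α) ∩ topk h (kstar p e α)).card := by
    rw [Nat.one_le_iff_ne_zero, Finset.card_ne_zero, ← Finset.not_disjoint_iff_nonempty_inter]
    intro hd
    have hmass := one_sub_le_sum_topk_kstar hsum e hα0.le
    have hle := sum_topk_le_sum_topk_of_disjoint halign hd
    have hunion : ∑ o ∈ topk e (kstar p e α) ∪ topk h (kstar p e α), p o ≤ ∑ o, p o :=
      Finset.sum_le_univ_sum_of_nonneg hp
    rw [Finset.sum_union hd, hsum] at hunion
    linarith
  have hcast : (1 : ℝ) ≤ ((topk e (kstar p e α) ∩ topk h (kstar p e α)).card : ℝ) := by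
    exact_mod_cast hcard
  exact ⟨by linarith, hcard⟩
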